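/- Let L be a finitely generated S-module and 𝔞 an ideal of S. Then for almost all α: (i) grade(𝔞_α, L_α) = grade(𝔞, L), and (ii) grade L_α = grade L, where grade(𝔞, L) is the length of a maximal L-regular sequence in 𝔞 and grade L = grade(Ann L, S). -/

import Mathlib

set_option maxHeartbeats 1000000
set_option synthInstance.maxHeartbeats 1000000

noncomputable section

namespace Spl

open MvPolynomial

/-- "Q(α) holds for almost all α ∈ K^m", i.e. away from a proper algebraic
subvariety of `K^m`. -/
def AlmostAll (K : Type) [Field K] (m : ℕ) (Q : (Fin m → K) → Prop) : Prop :=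
  ∃ c : MvPolynomial (Fin m) K, c ≠ 0 ∧ ∀ α : Fin m → K, MvPolynomial.eval α c ≠ 0 → Q α

variable (k K : Type) [Field k] [Field K] [Algebra k K]

/-- the field k(u) of rational functions in u = (u_1, ..., u_m) -/
abbrev kU (m : ℕ) := FractionRing (MvPolynomial (Fin m) k)

/-- the polynomial ring R = k(u)[X_1, ..., X_n] -/
abbrev Rg (m n : ℕ) := MvPolynomial (Fin n) (kU k m)

/-- the subfield k(α) ⊆ K generated by α = (α_1, ..., α_m) over k -/
abbrev kA {m : ℕ} (α : Fin m → K) := IntermediateField.adjoin k (Set.range α)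

/-- the polynomial ring R_α = k(α)[X_1, ..., X_n] -/
abbrev Ra {m : ℕ} (n : ℕ) (α : Fin m → K) := MvPolynomial (Fin n) (kA k K α)

/-- evaluation u ↦ α, from k[u] to k(α) -/
def evalα {m : ℕ} (α : Fin m → K) : MvPolynomial (Fin m) k →+* kA k K α :=
  (MvPolynomial.aeval fun i =>
    (⟨α i, IntermediateField.subset_adjoin k (Set.range α) ⟨i, rfl⟩⟩ : kA k K α)).toRingHom

/-- the inclusion k[u][X] → R = k(u)[X] -/
def toR (m n : ℕ) : MvPolynomial (Fin n) (MvPolynomial (Fin m) k) →+* Rg k m n :=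
  MvPolynomial.map (algebraMap (MvPolynomial (Fin m) k) (kU k m))

/-- substitution u ↦ α, from k[u][X] to R_α = k(α)[X] -/
def toRa {m : ℕ} (n : ℕ) (α : Fin m → K) :
    MvPolynomial (Fin n) (MvPolynomial (Fin m) k) →+* Ra k K n α :=
  MvPolynomial.map (evalα k K α)

/-- Krull's specialization I_α = { f(α,X) | f(u,X) ∈ I ∩ k[u,X] } of an ideal I ⊆ R
(as an ideal of R_α, i.e. the ideal spanned by the specialized elements). -/
def idealSpec {m : ℕ} (n : ℕ) (α : Fin m → K) (I : Ideal (Rg k m n)) :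
    Ideal (Ra k K n α) :=
  Ideal.span (toRa k K n α '' { f | toR k m n f ∈ I })

/-- `ElemSpec k K n α f fα` : fα is the specialization of f ∈ R at α, i.e. writing
f = p(u,X)/q(u) with q(α) ≠ 0 one has fα = p(α,X)/q(α). -/
def ElemSpec {m : ℕ} (n : ℕ) (α : Fin m → K) (f : Rg k m n) (fα : Ra k K n α) : Prop :=
  ∃ (p : MvPolynomial (Fin n) (MvPolynomial (Fin m) k)) (q : MvPolynomial (Fin m) k),
    evalα k K α q ≠ 0 ∧
    MvPolynomial.C (algebraMap (MvPolynomial (Fin m) k) (kU k m) q) * f = toR k m n p ∧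
    MvPolynomial.C (evalα k K α q) * fα = toRa k K n α p

variable {k K}

/-- `LocElemSpec P ℘ a aα` : aα ∈ S_α = (R_α)_℘ is the specialization of a ∈ S = R_P,
i.e. writing a = f/g with f, g ∈ R, g ∉ P, one has g_α ∉ ℘ and aα = f_α/g_α. -/
def LocElemSpec {m n : ℕ} {α : Fin m → K} (P : Ideal (Rg k m n)) [P.IsPrime]
    (℘ : Ideal (Ra k K n α)) [℘.IsPrime]
    {S : Type} [CommRing S] [Algebra (Rg k m n) S] [IsLocalization.AtPrime S P]
    {Sα : Type} [CommRing Sα] [Algebra (Ra k K n α) Sα] [IsLocalization.AtPrime Sα ℘]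
    (a : S) (aα : Sα) : Prop :=
  ∃ (f g : Rg k m n) (fα gα : Ra k K n α) (hg : g ∈ P.primeCompl)
    (hgα : gα ∈ ℘.primeCompl),
    ElemSpec k K n α f fα ∧ ElemSpec k K n α g gα ∧
    a = IsLocalization.mk' S f ⟨g, hg⟩ ∧
    aα = IsLocalization.mk' Sα fα ⟨gα, hgα⟩

/-- entrywise specialization of matrices, relative to an element-specialization
relation `E`. -/
def MatSpec {S T : Type} (E : S → T → Prop) {r s : ℕ}
    (A : Matrix (Fin r) (Fin s) S) (B : Matrix (Fin r) (Fin s) T) : Prop :=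
  ∀ i j, E (A i j) (B i j)

/-- the cokernel of the linear map attached to a matrix A, i.e. the module
presented by A. -/
abbrev MatCoker {S : Type} [CommRing S] {r s : ℕ} (A : Matrix (Fin r) (Fin s) S) :=
  (Fin r → S) ⧸ LinearMap.range A.mulVecLin

/-- a finite free presentation F_1 → F_0 → L → 0 of the module L, where the map
F_1 → F_0 is given by the matrix A and the map F_0 → L is π. -/
structure Present (S : Type) [CommRing S] (r s : ℕ) (L : Type) [AddCommGroup L]
    [Module S L] where
  A : Matrix (Fin r) (Fin s) S
  π : (Fin r → S) →ₗ[S] L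
  surj : Function.Surjective π
  ker_eq : LinearMap.ker π = LinearMap.range A.mulVecLin

theorem comm_le {S : Type} [CommRing S] {r s r' s' : ℕ} {B : Matrix (Fin r) (Fin s) S}
    {C : Matrix (Fin r') (Fin s') S} {W : Matrix (Fin r') (Fin r) S}
    {W1 : Matrix (Fin s') (Fin s) S} (h : W * B = C * W1) :
    LinearMap.range B.mulVecLin ≤ (LinearMap.range C.mulVecLin).comap W.mulVecLin := by
  rintro x ⟨y, rfl⟩
  exact ⟨W1.mulVecLin y, by
    simp only [Matrix.mulVecLin_apply, Matrix.mulVec_mulVec, h]⟩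

/-- the map between the modules presented by B and C induced by the matrix W
(a specialization of a lift of a map between the presented modules). -/
def cokerMap {S : Type} [CommRing S] {r s r' s' : ℕ} {B : Matrix (Fin r) (Fin s) S}
    {C : Matrix (Fin r') (Fin s') S} (W : Matrix (Fin r') (Fin r) S)
    (h : LinearMap.range B.mulVecLin ≤ (LinearMap.range C.mulVecLin).comap W.mulVecLin) :
    MatCoker B →ₗ[S] MatCoker C :=
  Submodule.mapQ _ _ W.mulVecLin h

/-- a lift of a homomorphism v : L → M to given finite free presentations of L and M:
a commutative diagram whose vertical maps are given by the matrices V1, V0. -/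
structure MapLift {S : Type} [CommRing S] {rL sL rM sM : ℕ} {L M : Type}
    [AddCommGroup L] [Module S L] [AddCommGroup M] [Module S M]
    (pL : Present S rL sL L) (pM : Present S rM sM M) (v : L →ₗ[S] M) where
  V0 : Matrix (Fin rM) (Fin rL) S
  V1 : Matrix (Fin sM) (Fin sL) S
  comm0 : pM.π ∘ₗ V0.mulVecLin = v ∘ₗ pL.π
  comm1 : V0 * pL.A = pM.A * V1

/-- Krull dimension of a module, dim L = dim S/Ann L. -/
def moduleDim (S : Type) [CommRing S] (L : Type) [AddCommGroup L] [Module S L] :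
    WithBot ℕ∞ :=
  ringKrullDim (S ⧸ Module.annihilator S L)

/-- height of an ideal: the infimum of dim S_p over the primes p ⊇ I. -/
def idealHeight {S : Type} [CommRing S] (I : Ideal S) : WithBot ℕ∞ :=
  sInf { d | ∃ (p : Ideal S) (hp : p.IsPrime), I ≤ p ∧
    d = ringKrullDim (Localization (@Ideal.primeCompl _ _ p hp)) }

/-- length of a module: the longest chain of submodules. -/
def moduleLength (S : Type) [CommRing S] (L : Type) [AddCommGroup L] [Module S L] :
    WithBot ℕ∞ :=
  Order.krullDim (Submodule S L)

/-- grade(𝔞, L) ≥ t : there is an L-regular sequence of length t in 𝔞. -/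
def GradeGE {S : Type} [CommRing S] (𝔞 : Ideal S) (L : Type) [AddCommGroup L]
    [Module S L] (t : ℕ) : Prop :=
  ∃ rs : List S, rs.length = t ∧ (∀ x ∈ rs, x ∈ 𝔞) ∧ RingTheory.Sequence.IsRegular L rs

/-- grade(𝔞, L) : the length of a maximal L-regular sequence in 𝔞. -/
def grade {S : Type} [CommRing S] (𝔞 : Ideal S) (L : Type) [AddCommGroup L]
    [Module S L] : ℕ∞ :=
  sSup { t : ℕ∞ | ∃ t' : ℕ, t = (t' : ℕ∞) ∧ GradeGE 𝔞 L t' }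

/-- depth of a module over a local ring: grade(𝔪, L). -/
def depth (S : Type) [CommRing S] [IsLocalRing S] (L : Type) [AddCommGroup L]
    [Module S L] : ℕ∞ :=
  grade (IsLocalRing.maximalIdeal S) L

/-- proj dim L ≤ d : L admits a finite free resolution of length ≤ d, encoded as a
(possibly infinite) free resolution ⋯ → F_1 → F_0 → L → 0 with F_j = 0 for j > d. -/
def ProjDimLE (S : Type) [CommRing S] (L : Type) [AddCommGroup L] [Module S L]
    (d : ℕ) : Prop :=
  ∃ (r : ℕ → ℕ) (A : ∀ j : ℕ, Matrix (Fin (r j)) (Fin (r (j + 1))) S)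
    (π : (Fin (r 0) → S) →ₗ[S] L),
    Function.Surjective π ∧ LinearMap.ker π = LinearMap.range (A 0).mulVecLin ∧
    (∀ j : ℕ, LinearMap.ker (A j).mulVecLin = LinearMap.range (A (j + 1)).mulVecLin) ∧
    ∀ j : ℕ, d < j → r j = 0

/-- projective dimension of a module, as an extended natural number. -/
def projDim (S : Type) [CommRing S] (L : Type) [AddCommGroup L] [Module S L] : ℕ∞ :=
  sInf { d : ℕ∞ | ∃ d' : ℕ, d = (d' : ℕ∞) ∧ ProjDimLE S L d' }

/-- the i-th local cohomology module H^i_𝔞(L) as a module. -/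
abbrev localCoh {S : Type} [CommRing S] (𝔞 : Ideal S) (i : ℕ) (L : Type)
    [AddCommGroup L] [Module S L] : ModuleCat S :=
  (localCohomology 𝔞 i).obj (ModuleCat.of S L)

/-- the colon submodule (0 :_L 𝔞) = { x ∈ L | 𝔞 x = 0 }. -/
def colonSubmodule {S : Type} [CommRing S] (𝔞 : Ideal S) (L : Type) [AddCommGroup L]
    [Module S L] : Submodule S L where
  carrier := { x | ∀ c ∈ 𝔞, c • x = 0 }
  add_mem' := by
    intro a b ha hb c hc
    rw [smul_add, ha c hc, hb c hc, add_zero]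
  zero_mem' := by
    intro c _
    rw [smul_zero]
  smul_mem' := by
    intro s x hx c hc
    rw [smul_comm, hx c hc, smul_zero]

/-- a (partial) system of parameters: the d = dim L elements a_1, ..., a_d lie in the
maximal ideal and L/(a_1, ..., a_d)L has dimension ≤ 0. -/
def IsSOP (S : Type) [CommRing S] [IsLocalRing S] (L : Type) [AddCommGroup L]
    [Module S L] {d : ℕ} (a : Fin d → S) : Prop :=
  (∀ i, a i ∈ IsLocalRing.maximalIdeal S) ∧
  moduleDim S L = (d : ℕ∞) ∧
  moduleDim S (L ⧸ (Ideal.span (Set.range a) • (⊤ : Submodule S L))) ≤ 0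

/-- a standard system of parameters: (a_1, ..., a_d) H^i_𝔪(L/(a_1, ..., a_j)L) = 0
for all i + j < d. -/
def IsStandardSOP (S : Type) [CommRing S] [IsLocalRing S] (L : Type) [AddCommGroup L]
    [Module S L] {d : ℕ} (a : Fin d → S) : Prop :=
  IsSOP S L a ∧
  ∀ i j : ℕ, i + j < d →
    Ideal.span (Set.range a) ≤ Module.annihilator S
      (localCoh (IsLocalRing.maximalIdeal S) i
        (L ⧸ (Ideal.span (a '' { x : Fin d | (x : ℕ) < j }) • (⊤ : Submodule S L))))

/-- a standard ideal for L: an 𝔪-primary ideal 𝔞 such that every system of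
parameters of L contained in 𝔞 is standard. -/
def IsStandardIdeal (S : Type) [CommRing S] [IsLocalRing S] (L : Type) [AddCommGroup L]
    [Module S L] (𝔞 : Ideal S) : Prop :=
  𝔞.radical = IsLocalRing.maximalIdeal S ∧
  ∀ (d : ℕ) (a : Fin d → S), (∀ i, a i ∈ 𝔞) → IsSOP S L a → IsStandardSOP S L a

section GenericTorVanishing

open TensorProduct

/-- Tensoring with `E` preserves injectivity of the kernel of any surjection onto `Q`;
equivalently, `Tor₁ᴬ(Q, E) = 0`. -/
def TorVanish (A : Type) [CommRing A] (E Q : Type) [AddCommGroup E] [Module A E]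
    [AddCommGroup Q] [Module A Q] : Prop :=
  ∀ (N : Type) [AddCommGroup N] [Module A N] (g : N →ₗ[A] Q), Function.Surjective g →
    Function.Injective ((LinearMap.ker g).subtype.rTensor E)

variable {A : Type} [CommRing A] {E Q Q' : Type} [AddCommGroup E] [Module A E]
  [AddCommGroup Q] [Module A Q] [AddCommGroup Q'] [Module A Q']

theorem TorVanish.rTensor_injective (h : TorVanish A E Q) {N N' : Type} [AddCommGroup N]
    [Module A N] [AddCommGroup N'] [Module A N'] (f : N →ₗ[A] N') (g : N' →ₗ[A] Q)
    (hf : Function.Injective f) (hg : Function.Surjective g) (hfg : Function.Exact f g) :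
    Function.Injective (f.rTensor E) := by
  have hr : LinearMap.ker g = LinearMap.range f := hfg.linearMap_ker_eq
  let e : N ≃ₗ[A] LinearMap.ker g :=
    LinearEquiv.ofInjective f hf ≪≫ₗ LinearEquiv.ofEq _ _ hr.symm
  have hfe : f = (LinearMap.ker g).subtype ∘ₗ e.toLinearMap := by ext; rfl
  rw [hfe, LinearMap.rTensor_comp, LinearMap.coe_comp]
  exact (h _ g hg).comp (e.rTensor E).injective

theorem TorVanish.of_equiv (e : Q ≃ₗ[A] Q') (h : TorVanish A E Q) : TorVanish A E Q' := by
  intro N _ _ g hg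
  refine h.rTensor_injective _ (e.symm.toLinearMap ∘ₗ g) (Submodule.subtype_injective _)
    (e.symm.surjective.comp hg) ?_
  rw [LinearMap.exact_iff, LinearEquiv.ker_comp, Submodule.range_subtype]

theorem TorVanish.of_flat [Module.Flat A Q] : TorVanish A E Q := by
  intro N _ _ g hg
  rw [← LinearMap.lTensor_inj_iff_rTensor_inj]
  refine LinearMap.lTensor_injective_of_exact_of_flat g hg _ (Submodule.subtype_injective _) ?_ E
  rw [LinearMap.exact_iff, Submodule.range_subtype]

theorem TorVanish.of_smul_eq_zero (c : A) (hc : ∀ q : Q, c • q = 0)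
    (hE : Function.Bijective fun x : E => c • x) : TorVanish A E Q := by
  intro N _ _ g hg
  let φ : N →ₗ[A] LinearMap.ker g :=
    (c • LinearMap.id).codRestrict _ fun x => by simp [hc]
  have hφ : φ ∘ₗ (LinearMap.ker g).subtype = c • LinearMap.id := by ext; rfl
  let eE : E ≃ₗ[A] E := LinearEquiv.ofBijective (c • LinearMap.id) hE
  have h1 : (c • LinearMap.id : LinearMap.ker g →ₗ[A] LinearMap.ker g).rTensor E
      = (eE.lTensor (LinearMap.ker g)).toLinearMap := by
    ext x y
    change (c • x) ⊗ₜ[A] y = x ⊗ₜ[A] (c • y)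
    rw [TensorProduct.smul_tmul]
  have h2 : Function.Injective (φ.rTensor E ∘ₗ (LinearMap.ker g).subtype.rTensor E) := by
    rw [← LinearMap.rTensor_comp, hφ, h1]
    exact LinearEquiv.injective _
  rw [LinearMap.coe_comp] at h2
  exact h2.of_comp

theorem TorVanish.of_ker (p : Q →ₗ[A] Q') (hp : Function.Surjective p)
    (h1 : TorVanish A E (LinearMap.ker p)) (h2 : TorVanish A E Q') : TorVanish A E Q := by
  intro N _ _ g hg
  have hle : LinearMap.ker g ≤ LinearMap.ker (p ∘ₗ g) := LinearMap.ker_le_ker_comp g p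
  let g' : LinearMap.ker (p ∘ₗ g) →ₗ[A] LinearMap.ker p :=
    g.restrict fun x hx => hx
  have hg' : Function.Surjective g' := by
    rintro ⟨y, hy⟩
    obtain ⟨x, rfl⟩ := hg y
    exact ⟨⟨x, hy⟩, rfl⟩
  have hex : Function.Exact (Submodule.inclusion hle) g' := by
    rintro ⟨x, hx⟩
    constructor
    · intro h
      exact ⟨⟨x, congrArg Subtype.val h⟩, rfl⟩
    · rintro ⟨y, hy⟩
      refine Subtype.ext ?_
      have : (y : N) = x := congrArg Subtype.val hy
      change g x = 0
      rw [← this]; exact y.2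
  have i1 := h1.rTensor_injective _ g' (Submodule.inclusion_injective hle) hg' hex
  have i2 := h2 N (p ∘ₗ g) (hp.comp hg)
  have : (LinearMap.ker g).subtype =
      (LinearMap.ker (p ∘ₗ g)).subtype ∘ₗ Submodule.inclusion hle := rfl
  rw [this, LinearMap.rTensor_comp, LinearMap.coe_comp]
  exact i2.comp i1

theorem TorVanish.of_iUnion (F : ℕ → Submodule A Q) (hmono : Monotone F)
    (hF : ∀ q, ∃ j, q ∈ F j) (h : ∀ j, TorVanish A E (F j)) : TorVanish A E Q := by
  intro N _ _ g hg
  rw [injective_iff_map_eq_zero]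
  intro x hx
  obtain ⟨J, hJ, hle, y, rfl⟩ := Submodule.exists_fg_le_eq_rTensor_inclusion x
  rw [← LinearMap.rTensor_comp_apply, Submodule.subtype_comp_inclusion] at hx
  obtain ⟨N', hN', hle', hy⟩ := hJ.exists_rTensor_fg_inclusion_eq (x := y) (y := 0)
    (by rw [hx, map_zero])
  rw [map_zero] at hy
  obtain ⟨s, rfl⟩ := hN'
  choose j hj using hF
  let j₀ := s.sup fun x => j (g x)
  have hN'' : Submodule.span A (s : Set N) ≤ (F j₀).comap g := by
    rw [Submodule.span_le]
    intro x hx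
    exact hmono (Finset.le_sup (f := fun x => j (g x)) hx) (hj (g x))
  have hk : LinearMap.ker g ≤ (F j₀).comap g := by
    intro x hx
    rw [Submodule.mem_comap, LinearMap.mem_ker.1 hx]
    exact zero_mem _
  let g' : (F j₀).comap g →ₗ[A] F j₀ := g.restrict fun x hx => hx
  have hg' : Function.Surjective g' := by
    rintro ⟨y, hy⟩
    obtain ⟨x, rfl⟩ := hg y
    exact ⟨⟨x, hy⟩, rfl⟩
  have hex : Function.Exact (Submodule.inclusion hk) g' := by
    rintro ⟨x, hx⟩
    constructor
    · intro h
      exact ⟨⟨x, congrArg Subtype.val h⟩, rfl⟩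
    · rintro ⟨y, hy⟩
      refine Subtype.ext ?_
      have : (y : N) = x := congrArg Subtype.val hy
      change g x = 0
      rw [← this]; exact y.2
  have i1 := (h j₀).rTensor_injective _ g' (Submodule.inclusion_injective hk) hg' hex
  apply i1
  rw [map_zero, ← LinearMap.rTensor_comp_apply]
  have : Submodule.inclusion hk ∘ₗ Submodule.inclusion hle =
      Submodule.inclusion hN'' ∘ₗ Submodule.inclusion hle' := rfl
  rw [this, LinearMap.rTensor_comp_apply, hy, map_zero]

/-- Every finitely generated `B`-module is generically `Tor`-acyclic over `A`. -/
def GenericallyTorVanishing (A B : Type) [CommRing A] [CommRing B] [Algebra A B] : Prop :=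
  ∀ (Q : Type) [AddCommGroup Q] [Module A Q] [Module B Q] [IsScalarTower A B Q]
    [Module.Finite B Q], ∃ c : A, c ≠ 0 ∧ ∀ (E : Type) [AddCommGroup E] [Module A E],
      (Function.Bijective fun x : E => c • x) → TorVanish A E Q

theorem bijective_smul_of_mul {a b : A} (h : Function.Bijective fun x : E => (a * b) • x) :
    (Function.Bijective fun x : E => a • x) ∧ Function.Bijective fun x : E => b • x := by
  have h1 : (fun x : E => (a * b) • x) = (fun x => a • x) ∘ fun x => b • x := by
    ext x; simp [mul_smul]
  have h2 : (fun x : E => (a * b) • x) = (fun x => b • x) ∘ fun x => a • x := by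
    ext x; simp [mul_comm a b, mul_smul]
  have h3 := h1 ▸ h
  have h4 := h2 ▸ h
  exact ⟨⟨h4.1.of_comp, h3.2.of_comp⟩, ⟨h3.1.of_comp, h4.2.of_comp⟩⟩

theorem TorVanish.of_exact {Q₁ : Type} [AddCommGroup Q₁] [Module A Q₁] (f : Q₁ →ₗ[A] Q)
    (p : Q →ₗ[A] Q') (hf : Function.Injective f) (hp : Function.Surjective p)
    (hfp : Function.Exact f p) (h1 : TorVanish A E Q₁) (h2 : TorVanish A E Q') :
    TorVanish A E Q :=
  .of_ker p hp (h1.of_equiv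
    (LinearEquiv.ofInjective f hf ≪≫ₗ LinearEquiv.ofEq _ _ hfp.linearMap_ker_eq.symm)) h2

theorem genericallyTorVanishing_self (A : Type) [CommRing A] [IsDomain A] [IsNoetherianRing A] :
    GenericallyTorVanishing A A := by
  have key : ∀ (Q : Type) [AddCommGroup Q] [Module A Q], Module.Finite A Q →
      ∃ c : A, c ≠ 0 ∧ ∀ (E : Type) [AddCommGroup E] [Module A E],
        (Function.Bijective fun x : E => c • x) → TorVanish A E Q := by
    intro Q _ _ hQ
    induction hQ using IsNoetherianRing.induction_on_isQuotientEquivQuotientPrime A with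
    | subsingleton N =>
      exact ⟨1, one_ne_zero, fun E _ _ _ => .of_flat⟩
    | quotient N p e =>
      by_cases hp : p.1 = ⊥
      · refine ⟨1, one_ne_zero, fun E _ _ _ => ?_⟩
        have e' : A ≃ₗ[A] N := (Submodule.quotEquivOfEqBot _ hp).symm ≪≫ₗ e.symm
        exact TorVanish.of_flat.of_equiv e'
      · obtain ⟨c, hc, hc0⟩ := Submodule.exists_mem_ne_zero_of_ne_bot hp
        refine ⟨c, hc0, fun E _ _ hE => (TorVanish.of_smul_eq_zero c ?_ hE).of_equiv e.symm⟩
        intro q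
        obtain ⟨a, rfl⟩ := Ideal.Quotient.mk_surjective q
        change Ideal.Quotient.mk p.1 (c * a) = 0
        exact Ideal.Quotient.eq_zero_iff_mem.2 (Ideal.mul_mem_right _ _ hc)
    | exact N₁ N₂ N₃ f g hf hg hfg h1 h3 =>
      obtain ⟨c, hc, h1⟩ := h1
      obtain ⟨d, hd, h3⟩ := h3
      refine ⟨c * d, mul_ne_zero hc hd, fun E _ _ hE => ?_⟩
      obtain ⟨hE1, hE3⟩ := bijective_smul_of_mul hE
      exact .of_exact f g hf hg hfg (h1 E hE1) (h3 E hE3)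
  intro Q _ m₁ m₂ hst hfin
  have : m₁ = m₂ := by
    refine Module.ext' _ _ fun r x => ?_
    have := hst.smul_assoc r 1 x
    rw [smul_eq_mul, mul_one, one_smul] at this
    exact this.symm
  subst this
  exact key Q hfin

theorem GenericallyTorVanishing.of_algEquiv {A B B' : Type} [CommRing A] [CommRing B] [CommRing B']
    [Algebra A B] [Algebra A B'] (e : B ≃ₐ[A] B') (h : GenericallyTorVanishing A B) :
    GenericallyTorVanishing A B' := by
  intro Q _ _ _ _ _
  let _ : Module B Q := Module.compHom Q (e : B →+* B')
  have : IsScalarTower A B Q := ⟨fun a b q => by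
    change e (a • b) • q = a • e b • q
    rw [map_smul, smul_assoc]⟩
  have : Module.Finite B Q := by
    let _ := (e : B →+* B').toAlgebra
    have : IsScalarTower B B' Q := ⟨fun a b q => by
      change (e a * b) • q = e a • b • q
      rw [mul_smul]⟩
    have : Module.Finite B B' := Module.Finite.of_surjective (Algebra.linearMap B B')
      e.surjective
    exact Module.Finite.trans B' Q
  exact h Q

open Polynomial in
theorem GenericallyTorVanishing.polynomial {A B : Type} [CommRing A] [IsDomain A] [CommRing B]
    [Algebra A B] [IsNoetherianRing B] (h : GenericallyTorVanishing A B) :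
    GenericallyTorVanishing A B[X] := by
  intro Q _ _ _ _ hfin
  let _ : Module B Q := Module.compHom Q (C : B →+* B[X])
  have hC : ∀ (b : B) (q : Q), b • q = (C b : B[X]) • q := fun _ _ => rfl
  have : IsScalarTower A B Q := ⟨fun a b q => by
    rw [hC, hC, ← smul_C, smul_assoc]⟩
  have : IsScalarTower B B[X] Q := ⟨fun a b q => by
    rw [hC, ← mul_smul, Polynomial.smul_eq_C_mul]⟩
  obtain ⟨s, hs⟩ := hfin
  let M₀ : Submodule B Q := Submodule.span B (s : Set Q)
  obtain ⟨T, hT⟩ : ∃ T : Module.End B Q, ∀ q, T q = (X : B[X]) • q :=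
    ⟨{ toFun := fun q => (X : B[X]) • q
       map_add' := fun _ _ => smul_add _ _ _
       map_smul' := fun b q => by
        rw [RingHom.id_apply, hC, hC, ← mul_smul, ← mul_smul, mul_comm] }, fun _ => rfl⟩
  obtain ⟨F, hF0, hF1⟩ : ∃ F : ℕ → Submodule B Q, F 0 = M₀ ∧
      ∀ j, F (j + 1) = F j ⊔ M₀.map (T ^ (j + 1)) :=
    ⟨fun j => Nat.rec M₀ (fun j N => N ⊔ M₀.map (T ^ (j + 1))) j, rfl, fun _ => rfl⟩
  have hmono : Monotone F := monotone_nat_of_le_succ fun j => by rw [hF1]; exact le_sup_left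
  have hTF : ∀ j, ∀ q ∈ F j, T q ∈ F (j + 1) := by
    intro j
    change F j ≤ (F (j + 1)).comap T
    induction j with
    | zero =>
      intro q hq
      rw [Submodule.mem_comap, hF1]
      refine Submodule.mem_sup_right ⟨q, hF0 ▸ hq, ?_⟩
      rw [zero_add, pow_one]
    | succ j ih =>
      rw [hF1, sup_le_iff]
      constructor
      · intro q hq
        exact hmono (Nat.le_succ _) (ih hq)
      · rintro _ ⟨q, hq, rfl⟩
        rw [Submodule.mem_comap, hF1 (j + 1)]
        refine Submodule.mem_sup_right ⟨q, hq, ?_⟩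
        rw [pow_succ' T (j + 1)]; rfl
  have hTF' : ∀ n j, ∀ q ∈ F j, (Polynomial.X ^ n : B[X]) • q ∈ F (j + n) := by
    intro n
    induction n with
    | zero => intro j q hq; simpa using hq
    | succ n ih =>
      intro j q hq
      rw [pow_succ', mul_smul, ← hT]
      exact hTF _ _ (ih j q hq)
  have hex : ∀ q, ∃ j, q ∈ F j := by
    intro q
    have hq : q ∈ Submodule.span B[X] (s : Set Q) := hs ▸ Submodule.mem_top
    induction hq using Submodule.span_induction with
    | mem x hx => exact ⟨0, hF0 ▸ Submodule.subset_span hx⟩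
    | zero => exact ⟨0, zero_mem _⟩
    | add x y _ _ hx hy =>
      obtain ⟨i, hi⟩ := hx
      obtain ⟨j, hj⟩ := hy
      exact ⟨max i j, add_mem (hmono (le_max_left _ _) hi) (hmono (le_max_right _ _) hj)⟩
    | smul p x _ hx =>
      obtain ⟨j, hj⟩ := hx
      induction p using Polynomial.induction_on' with
      | add p q hp hq =>
        obtain ⟨i, hi⟩ := hp
        obtain ⟨l, hl⟩ := hq
        refine ⟨max i l, ?_⟩
        rw [add_smul]
        exact add_mem (hmono (le_max_left _ _) hi) (hmono (le_max_right _ _) hl)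
      | monomial n b =>
        refine ⟨j + n, ?_⟩
        rw [← Polynomial.C_mul_X_pow_eq_monomial, mul_smul, ← hC]
        exact Submodule.smul_mem _ _ (hTF' n j x hj)
  let φ : ∀ j, M₀ →ₗ[B] Q ⧸ F j := fun j => (F j).mkQ ∘ₗ (T ^ (j + 1)) ∘ₗ M₀.subtype
  have hφ : ∀ j (x : M₀), φ j x = 0 ↔ (T ^ (j + 1)) (x : Q) ∈ F j := fun j x =>
    Submodule.Quotient.mk_eq_zero _
  let κ : ℕ →o Submodule B M₀ := ⟨fun j => LinearMap.ker (φ j),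
    monotone_nat_of_le_succ fun j x hx => by
    rw [LinearMap.mem_ker, hφ] at hx ⊢
    rw [pow_succ']
    exact hTF _ _ hx⟩
  have : Module.Finite B M₀ := Module.Finite.span_finset B s
  obtain ⟨J, hJ⟩ := monotone_stabilizes_iff_noetherian.2 (inferInstance : IsNoetherian B M₀) κ
  choose c hc hcE using fun j => h (M₀ ⧸ LinearMap.ker (φ j))
  obtain ⟨c₀, hc₀, hc₀E⟩ := h M₀
  refine ⟨c₀ * ∏ j ∈ Finset.range (J + 1), c j,
    mul_ne_zero hc₀ (Finset.prod_ne_zero_iff.2 fun j _ => hc j), fun E _ _ hE => ?_⟩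
  obtain ⟨hE₀, hE⟩ := bijective_smul_of_mul hE
  have hquot : ∀ j, TorVanish A E (M₀ ⧸ LinearMap.ker (φ j)) := by
    have hle : ∀ j ≤ J, TorVanish A E (M₀ ⧸ LinearMap.ker (φ j)) := by
      intro j hj
      rw [← Finset.mul_prod_erase _ _ (Finset.mem_range.2 (Nat.lt_succ_of_le hj))] at hE
      exact hcE j E (bijective_smul_of_mul hE).1
    intro j
    rcases le_total j J with hj | hj
    · exact hle j hj
    · have : LinearMap.ker (φ J) = LinearMap.ker (φ j) := hJ j hj
      rw [← this]
      exact hle J le_rfl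
  have hFj : ∀ j, TorVanish A E (F j) := by
    intro j
    induction j with
    | zero => rw [hF0]; exact hc₀E E hE₀
    | succ j ih =>
      let ψ : F (j + 1) →ₗ[B] Q ⧸ F j := (F j).mkQ ∘ₗ (F (j + 1)).subtype
      have hψ : LinearMap.range ψ = LinearMap.range (φ j) := by
        rw [LinearMap.range_comp, Submodule.range_subtype, hF1, Submodule.map_sup,
          LinearMap.range_comp, LinearMap.range_comp, Submodule.range_subtype,
          Submodule.mkQ_map_self, bot_sup_eq]
      refine .of_exact ((Submodule.inclusion (hmono j.le_succ : F j ≤ F (j + 1))).restrictScalars A)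
        (ψ.rangeRestrict.restrictScalars A)
        (Submodule.inclusion_injective (hmono j.le_succ : F j ≤ F (j + 1)))
        ψ.surjective_rangeRestrict ?_ ih ((hquot j).of_equiv
          (((φ j).quotKerEquivRange ≪≫ₗ LinearEquiv.ofEq _ _ hψ.symm).restrictScalars A))
      rintro ⟨x, hx⟩
      have h0 : ψ.rangeRestrict ⟨x, hx⟩ = 0 ↔ x ∈ F j := by
        rw [Subtype.ext_iff]
        exact Submodule.Quotient.mk_eq_zero _
      refine h0.trans ⟨fun hx' => ⟨⟨x, hx'⟩, rfl⟩, ?_⟩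
      rintro ⟨⟨y, hy⟩, hyx⟩
      have hyx' : y = x := congrArg Subtype.val hyx
      exact hyx' ▸ hy
  exact .of_iUnion (fun j => (F j).restrictScalars A) hmono hex hFj

theorem genericallyTorVanishing_mvPolynomial (A : Type) [CommRing A] [IsDomain A]
    [IsNoetherianRing A] (n : ℕ) : GenericallyTorVanishing A (MvPolynomial (Fin n) A) := by
  induction n with
  | zero =>
    exact (genericallyTorVanishing_self A).of_algEquiv (MvPolynomial.isEmptyAlgEquiv A (Fin 0)).symm
  | succ n ih =>
    exact ih.polynomial.of_algEquiv (MvPolynomial.finSuccEquiv A n).symm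

end GenericTorVanishing

section Grade

open IsLocalRing RingTheory.Sequence CategoryTheory Abelian
open scoped Pointwise

variable {C : Type} [CommRing C]

theorem grade_congr (J : Ideal C) {N N' : Type} [AddCommGroup N] [Module C N] [AddCommGroup N']
    [Module C N'] (e : N ≃ₗ[C] N') : grade J N = grade J N' := by
  unfold grade GradeGE
  simp only [e.isRegular_congr]

theorem le_grade_of_gradeGE {J : Ideal C} {N : Type} [AddCommGroup N] [Module C N] {t : ℕ}
    (h : GradeGE J N t) : (t : ℕ∞) ≤ grade J N :=
  le_sSup ⟨t, rfl, h⟩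

theorem grade_le_iff {J : Ideal C} {N : Type} [AddCommGroup N] [Module C N] {d : ℕ∞} :
    grade J N ≤ d ↔ ∀ t : ℕ, GradeGE J N t → (t : ℕ∞) ≤ d := by
  refine ⟨fun h t ht => (le_grade_of_gradeGE ht).trans h, fun h => sSup_le ?_⟩
  rintro _ ⟨t, rfl, ht⟩
  exact h t ht

theorem grade_eq_zero_of_subsingleton (J : Ideal C) (N : Type) [AddCommGroup N] [Module C N]
    [Subsingleton N] : grade J N = 0 := by
  refine le_antisymm (grade_le_iff.2 ?_) zero_le
  rintro t ⟨rs, -, -, hrs⟩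
  have := hrs.nontrivial
  exact (not_subsingleton N inferInstance).elim

theorem grade_eq_zero_of_smul_eq_zero {J : Ideal C} {N : Type} [AddCommGroup N] [Module C N]
    {y : N} (hy : y ≠ 0) (hJ : ∀ c ∈ J, c • y = 0) : grade J N = 0 := by
  refine le_antisymm (grade_le_iff.2 ?_) zero_le
  rintro t ⟨rs, rfl, hmem, hrs⟩
  cases rs with
  | nil => simp
  | cons x rs =>
    have hx : IsSMulRegular N x := ((isRegular_cons_iff N x rs).1 hrs).1
    exact (hy (hx.right_eq_zero_of_smul (hJ x (hmem x (by simp))))).elim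

theorem grade_top [IsLocalRing C] (N : Type) [AddCommGroup N] [Module C N] :
    grade (⊤ : Ideal C) N = grade (maximalIdeal C) N := by
  have key : ∀ t, GradeGE (⊤ : Ideal C) N t ↔ GradeGE (maximalIdeal C) N t := by
    intro t
    refine ⟨?_, fun ⟨rs, hlen, _, hrs⟩ => ⟨rs, hlen, fun _ _ => trivial, hrs⟩⟩
    rintro ⟨rs, hlen, -, hrs⟩
    refine ⟨rs, hlen, fun x hx => ?_, hrs⟩
    by_contra hu
    have htop : Ideal.ofList rs = ⊤ :=
      Ideal.eq_top_of_isUnit_mem _ (Ideal.subset_span hx) (by simpa using hu)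
    exact hrs.top_ne_smul (by rw [htop, Submodule.top_smul])
  unfold grade
  simp only [key]

theorem smul_top_lt_top [IsLocalRing C] {J : Ideal C} (hJ : J ≤ maximalIdeal C) (N : Type)
    [AddCommGroup N] [Module C N] [Nontrivial N] [Module.Finite C N] : J • (⊤ : Submodule C N) < ⊤ :=
  lt_of_le_of_ne le_top (Submodule.top_ne_ideal_smul_of_le_jacobson_annihilator
    (hJ.trans (maximalIdeal_le_jacobson _))).symm

variable [IsLocalRing C] [IsNoetherianRing C]

theorem gradeGE_succ_iff {J : Ideal C} (hJ : J ≤ maximalIdeal C) {N : Type} [AddCommGroup N]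
    [Module C N] [Nontrivial N] [Module.Finite C N] {x : C} (hx : x ∈ J)
    (hreg : IsSMulRegular N x) (t : ℕ) :
    GradeGE J N (t + 1) ↔ GradeGE J (QuotSMulTop x N) t := by
  constructor
  · rintro ⟨rs, hlen, hmem, hrs⟩
    have : Nontrivial (QuotSMulTop x N) := nontrivial_quotSMulTop_of_mem_maximalIdeal N (hJ hx)
    let Q : ModuleCat C := ModuleCat.of C (C ⧸ J)
    have hsupp : Module.support C Q = PrimeSpectrum.zeroLocus J := by
      rw [Module.support_eq_zeroLocus, Ideal.annihilator_quotient]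
    have : Module.Finite C Q := inferInstanceAs (Module.Finite C (C ⧸ J))
    have hext := ModuleCat.subsingleton_ext_of_exists_isRegular J Q hsupp.subset
      (ModuleCat.of C N) (smul_top_lt_top hJ N) rs hmem hrs
    have hreg' : IsSMulRegular (ModuleCat.of C N) x := hreg
    refine ModuleCat.exists_isRegular_of_exists_subsingleton_ext J t
      (ModuleCat.of C (QuotSMulTop x N)) (smul_top_lt_top hJ _) Q hsupp fun i hi => ?_
    have zero1 := AddCommGrpCat.isZero_of_iff_subsingleton.mpr (hext i (by omega))
    have zero2 := AddCommGrpCat.isZero_of_iff_subsingleton.mpr (hext (i + 1) (by omega))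
    exact AddCommGrpCat.subsingleton_of_isZero <| ShortComplex.Exact.isZero_of_both_zeros
      ((Ext.covariant_sequence_exact₃' Q hreg'.smulShortComplex_shortExact) i (i + 1) rfl)
      (zero1.eq_zero_of_src _) (zero2.eq_zero_of_tgt _)
  · rintro ⟨rs, hlen, hmem, hrs⟩
    exact ⟨x :: rs, by simp [hlen], by simpa [hx] using hmem, hrs.cons hreg⟩

theorem grade_eq_add_one {J : Ideal C} (hJ : J ≤ maximalIdeal C) {N : Type} [AddCommGroup N]
    [Module C N] [Nontrivial N] [Module.Finite C N] {x : C} (hx : x ∈ J)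
    (hreg : IsSMulRegular N x) :
    grade J N = grade J (QuotSMulTop x N) + 1 := by
  apply le_antisymm
  · refine grade_le_iff.2 fun t ht => ?_
    cases t with
    | zero => simp
    | succ t =>
      push_cast
      gcongr
      exact le_grade_of_gradeGE ((gradeGE_succ_iff hJ hx hreg t).1 ht)
  · rcases eq_or_ne (grade J N) ⊤ with h | h
    · rw [h]; exact le_top
    · obtain ⟨d, hd⟩ := ENat.ne_top_iff_exists.1 h
      rw [← hd]
      cases d with
      | zero =>
        have : Nontrivial (QuotSMulTop x N) :=
          nontrivial_quotSMulTop_of_mem_maximalIdeal N (hJ hx)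
        have h1 := le_grade_of_gradeGE ((gradeGE_succ_iff hJ hx hreg 0).2
          ⟨[], rfl, by simp, .nil C _⟩)
        rw [← hd] at h1
        exact absurd h1 (by norm_num)
      | succ d =>
        push_cast
        gcongr
        refine grade_le_iff.2 fun t ht => ?_
        have h1 := le_grade_of_gradeGE ((gradeGE_succ_iff hJ hx hreg t).2 ht)
        rw [← hd] at h1
        push_cast at h1
        exact (ENat.add_le_add_iff_right (by simp)).1 h1

end Grade

section GenericSpecialization

open IsLocalRing TensorProduct Filter
open scoped Pointwise

/-- A Noetherian local algebra over `B`. -/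
structure LocAlg (B : Type) [CommRing B] where
  C : Type
  [commRing : CommRing C]
  [algebra : Algebra B C]
  [isLocalRing : IsLocalRing C]
  [isNoetherianRing : IsNoetherianRing C]

attribute [instance] LocAlg.commRing LocAlg.algebra LocAlg.isLocalRing LocAlg.isNoetherianRing

variable {B : Type} [CommRing B]

/-- Base change along almost every algebra in the filter preserves injectivity, and almost every
maximal ideal is the annihilator of an element modulo the extension of `p`. -/
structure GenericSpecialization (p : Ideal B) (F : Filter (LocAlg B)) : Prop where
  lTensor_injective : ∀ (N N' : Type) [AddCommGroup N] [AddCommGroup N'] [Module B N]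
    [Module B N'] [Module.Finite B N] [Module.Finite B N'] (f : N →ₗ[B] N'),
    Function.Injective f → ∀ᶠ A in F, Function.Injective (f.lTensor A.C)
  socle : ∀ᶠ A in F, ∃ z : A.C, z ∉ p.map (algebraMap B A.C) ∧
    ∀ c ∈ maximalIdeal A.C, c * z ∈ p.map (algebraMap B A.C)

theorem tmul_mk_one_eq_zero_iff {C : Type} [CommRing C] [Algebra B C] (Q : Ideal B) (c : C) :
    c ⊗ₜ[B] (1 : B ⧸ Q) = 0 ↔ c ∈ Q.map (algebraMap B C) := by
  rw [← Algebra.TensorProduct.quotIdealMapEquivTensorQuot_mk, EmbeddingLike.map_eq_zero_iff]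
  exact Submodule.Quotient.mk_eq_zero _

theorem tmul_eq_algebraMap_smul {C : Type} [CommRing C] [Algebra B C] {M : Type} [AddCommGroup M]
    [Module B M] (h : B) (y : C ⊗[B] M) : h • y = algebraMap B C h • y :=
  (algebraMap_smul C h y).symm

theorem smul_eq_zero_of_annihilates {C : Type} [CommRing C] [Algebra B C] {M : Type}
    [AddCommGroup M] [Module B M] {h : B} (hM : ∀ x : M, h • x = 0) (y : C ⊗[B] M) :
    h • y = 0 := by
  induction y with
  | zero => simp
  | tmul c x => rw [← tmul_smul, hM, tmul_zero]
  | add x y hx hy => rw [smul_add, hx, hy, add_zero]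

theorem exists_associatedPrime_le [IsNoetherianRing B] {M : Type} [AddCommGroup M] [Module B M]
    [Module.Finite B M] {p : Ideal B} [p.IsPrime] (h : Module.annihilator B M ≤ p) :
    ∃ Q ∈ associatedPrimes B M, Q ≤ p := by
  obtain ⟨Q, hQ, hQp⟩ := Ideal.exists_minimalPrimes_le h
  exact ⟨Q, Module.associatedPrimes.minimalPrimes_annihilator_subset_associatedPrimes B M hQ, hQp⟩

/-- A filtered version of prime avoidance: an element of `I` avoiding all the associated primes of
`M` below `p` acts on `M` with kernel vanishing at `p`. -/
theorem exists_mem_annihilator_ker_not_le [IsNoetherianRing B] {M : Type} [AddCommGroup M]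
    [Module B M] [Module.Finite B M] {p I : Ideal B} [p.IsPrime]
    (h : ∀ Q ∈ associatedPrimes B M, Q ≤ p → ¬ I ≤ Q) :
    ∃ x ∈ I, ¬ Module.annihilator B (LinearMap.ker (LinearMap.lsmul B M x)) ≤ p := by
  have hfin : {Q ∈ associatedPrimes B M | Q ≤ p}.Finite :=
    (associatedPrimes.finite B M).subset fun _ hQ => hQ.1
  have havoid : ¬ ((I : Set B) ⊆ ⋃ Q ∈ {Q ∈ associatedPrimes B M | Q ≤ p}, (Q : Set B)) := by
    intro hsub
    obtain ⟨Q, hQ, hIQ⟩ := (Ideal.subset_union_prime_finite hfin (f := id) 0 0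
      fun Q hQ _ _ => hQ.1.isPrime).1 hsub
    exact h Q hQ.1 hQ.2 hIQ
  obtain ⟨x, hxI, hx⟩ := Set.not_subset.1 havoid
  refine ⟨x, hxI, fun hle => hx ?_⟩
  obtain ⟨Q, hQ, hQp⟩ := exists_associatedPrime_le hle
  have hQM : Q ∈ associatedPrimes B M :=
    associatedPrimes.subset_of_injective (Submodule.subtype_injective _) hQ
  refine Set.mem_biUnion (show Q ∈ {Q ∈ associatedPrimes B M | Q ≤ p} from ⟨hQM, hQp⟩) ?_
  refine (IsAssociatedPrime.annihilator_le hQ) (Submodule.mem_annihilator.2 fun y _ => ?_)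
  exact Subtype.ext y.2

namespace GenericSpecialization

variable {p : Ideal B} {F : Filter (LocAlg B)}

theorem map_le (hF : GenericSpecialization p F) :
    ∀ᶠ A in F, p.map (algebraMap B A.C) ≤ maximalIdeal A.C := by
  filter_upwards [hF.socle] with A ⟨z, hz, _⟩
  exact le_maximalIdeal fun h => hz (h ▸ Submodule.mem_top)

theorem isUnit [hp : p.IsPrime] (hF : GenericSpecialization p F) {h : B} (hh : h ∉ p) :
    ∀ᶠ A in F, IsUnit (algebraMap B A.C h) := by
  have hinj : Function.Injective (LinearMap.lsmul B (B ⧸ p) h) := by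
    rw [injective_iff_map_eq_zero]
    intro y hy
    obtain ⟨b, rfl⟩ := Ideal.Quotient.mk_surjective y
    have hb : h * b ∈ p := Ideal.Quotient.eq_zero_iff_mem.1 hy
    exact Ideal.Quotient.eq_zero_iff_mem.2 ((hp.mem_or_mem hb).resolve_left hh)
  filter_upwards [hF.socle, hF.lTensor_injective _ _ _ hinj] with A ⟨z, hz, hz'⟩ hA
  by_contra hu
  apply hz
  rw [← tmul_mk_one_eq_zero_iff]
  apply hA
  rw [map_zero]
  change z ⊗ₜ[B] (h • (1 : B ⧸ p)) = 0
  rw [tmul_smul, smul_tmul', Algebra.smul_def, tmul_mk_one_eq_zero_iff]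
  exact hz' _ ((mem_maximalIdeal _).2 hu)

theorem lTensor_injective_of_ker [IsNoetherianRing B] [p.IsPrime]
    (hF : GenericSpecialization p F) {N N' : Type}
    [AddCommGroup N] [AddCommGroup N'] [Module B N] [Module B N'] [Module.Finite B N]
    [Module.Finite B N'] (f : N →ₗ[B] N') (h : ¬ Module.annihilator B (LinearMap.ker f) ≤ p) :
    ∀ᶠ A in F, Function.Injective (f.lTensor A.C) := by
  obtain ⟨h, hker, hp⟩ := SetLike.not_le_iff_exists.1 h
  filter_upwards [hF.isUnit hp,
    hF.lTensor_injective _ _ (LinearMap.range f).subtype (Submodule.subtype_injective _)]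
    with A hu hA
  have hex : Function.Exact (LinearMap.ker f).subtype f.rangeRestrict := by
    rw [LinearMap.exact_iff, LinearMap.ker_rangeRestrict, Submodule.range_subtype]
  have hex' := lTensor_exact A.C hex f.surjective_rangeRestrict
  have hf : f = (LinearMap.range f).subtype ∘ₗ f.rangeRestrict := rfl
  rw [hf, LinearMap.lTensor_comp, LinearMap.coe_comp]
  refine hA.comp ((injective_iff_map_eq_zero _).2 fun y hy => ?_)
  obtain ⟨w, rfl⟩ := (hex' y).1 hy
  have hw : algebraMap B A.C h • w = 0 := by
    rw [← tmul_eq_algebraMap_smul]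
    exact smul_eq_zero_of_annihilates (Module.mem_annihilator.1 hker) w
  rw [(hu.smul_eq_zero).1 hw, map_zero]

theorem isSMulRegular [IsNoetherianRing B] [p.IsPrime] (hF : GenericSpecialization p F)
    {M : Type} [AddCommGroup M] [Module B M] [Module.Finite B M] {x : B}
    (h : ¬ Module.annihilator B (LinearMap.ker (LinearMap.lsmul B M x)) ≤ p) :
    ∀ᶠ A in F, IsSMulRegular (A.C ⊗[B] M) (algebraMap B A.C x) := by
  filter_upwards [hF.lTensor_injective_of_ker _ h] with A hA
  have : ⇑((LinearMap.lsmul B M x).lTensor A.C) = fun y => algebraMap B A.C x • y := by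
    ext y
    rw [← tmul_eq_algebraMap_smul]
    induction y with
    | zero => simp
    | tmul c m => simp
    | add a b ha hb => rw [map_add, smul_add, ha, hb]
  rw [this] at hA
  exact hA

theorem subsingleton [p.IsPrime] (hF : GenericSpecialization p F)
    {M : Type} [AddCommGroup M] [Module B M] (h : ¬ Module.annihilator B M ≤ p) :
    ∀ᶠ A in F, Subsingleton (A.C ⊗[B] M) := by
  obtain ⟨h, hM, hp⟩ := SetLike.not_le_iff_exists.1 h
  filter_upwards [hF.isUnit hp] with A hu
  refine subsingleton_of_forall_eq 0 fun y => hu.smul_eq_zero.1 ?_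
  rw [← tmul_eq_algebraMap_smul]
  exact smul_eq_zero_of_annihilates (Module.mem_annihilator.1 hM) y

theorem exists_tmul_eq_zero_iff [IsNoetherianRing B] (hF : GenericSpecialization p F)
    {M : Type} [AddCommGroup M] [Module B M] [Module.Finite B M] {Q : Ideal B}
    (hQ : Q ∈ associatedPrimes B M) :
    ∃ x : M, ∀ᶠ A in F, ∀ c : A.C, c ⊗ₜ[B] x = 0 ↔ c ∈ Q.map (algebraMap B A.C) := by
  obtain ⟨-, f, hf⟩ := (isAssociatedPrime_iff_exists_injective_linearMap Q M).1 hQ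
  refine ⟨f 1, ?_⟩
  filter_upwards [hF.lTensor_injective _ _ f hf] with A hA c
  rw [← tmul_mk_one_eq_zero_iff, ← LinearMap.lTensor_tmul]
  exact map_eq_zero_iff _ hA

theorem nontrivial [IsNoetherianRing B] [p.IsPrime] (hF : GenericSpecialization p F)
    {M : Type} [AddCommGroup M] [Module B M] [Module.Finite B M]
    (h : Module.annihilator B M ≤ p) : ∀ᶠ A in F, Nontrivial (A.C ⊗[B] M) := by
  obtain ⟨Q, hQ, hQp⟩ := exists_associatedPrime_le h
  obtain ⟨x, hx⟩ := hF.exists_tmul_eq_zero_iff hQ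
  filter_upwards [hx, hF.map_le] with A hx hle
  refine nontrivial_of_ne (1 ⊗ₜ[B] x) 0 fun h => ?_
  exact (Ideal.ne_top_iff_one _).1 (maximalIdeal.isMaximal A.C).ne_top
    (hle (Ideal.map_mono hQp ((hx 1).1 h)))

/-- If some associated prime of `M` lies between `I` and `p`, the grade vanishes generically. -/
theorem grade_eq_zero [IsNoetherianRing B] (hF : GenericSpecialization p F)
    {M : Type} [AddCommGroup M] [Module B M] [Module.Finite B M] {Q : Ideal B}
    (hQ : Q ∈ associatedPrimes B M) (J : ∀ A : LocAlg B, Ideal A.C)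
    (hJ : ∀ᶠ A in F, ∃ z : A.C, z ∉ Q.map (algebraMap B A.C) ∧
      ∀ c ∈ J A, c * z ∈ Q.map (algebraMap B A.C)) :
    ∀ᶠ A in F, grade (J A) (A.C ⊗[B] M) = 0 := by
  obtain ⟨x, hx⟩ := hF.exists_tmul_eq_zero_iff hQ
  filter_upwards [hx, hJ] with A hx ⟨z, hz, hJz⟩
  refine grade_eq_zero_of_smul_eq_zero (y := z ⊗ₜ[B] x) (fun h => hz ((hx z).1 h)) fun c hc => ?_
  rw [smul_tmul', smul_eq_mul]
  exact (hx _).2 (hJz c hc)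

theorem exists_grade_eq_of_family [IsNoetherianRing B] [p.IsPrime]
    (hF : GenericSpecialization p F) (I : Ideal B) (J : ∀ A : LocAlg B, Ideal A.C)
    (hIJ : ∀ᶠ A in F, I.map (algebraMap B A.C) ≤ J A)
    (hJm : ∀ᶠ A in F, J A ≤ maximalIdeal A.C)
    (hJ : ∀ Q : Ideal B, I ≤ Q → Q ≤ p → ∀ᶠ A in F, ∃ z : A.C, z ∉ Q.map (algebraMap B A.C) ∧
      ∀ c ∈ J A, c * z ∈ Q.map (algebraMap B A.C))
    (M : Type) [AddCommGroup M] [Module B M] [Module.Finite B M] :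
    ∃ d : ℕ∞, ∀ᶠ A in F, grade (J A) (A.C ⊗[B] M) = d := by
  suffices key : ∀ N : Submodule B M, ∃ d : ℕ∞, ∀ᶠ A in F, grade (J A) (A.C ⊗[B] (M ⧸ N)) = d by
    obtain ⟨d, hd⟩ := key ⊥
    refine ⟨d, hd.mono fun A hA => ?_⟩
    rw [← hA]
    exact grade_congr _ ((Submodule.quotEquivOfEqBot (⊥ : Submodule B M) rfl).symm.baseChange
      B A.C _ _)
  intro N
  induction N using WellFoundedGT.induction with
  | ind N ih =>
    by_cases h0 : Module.annihilator B (M ⧸ N) ≤ p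
    swap
    · exact ⟨0, (hF.subsingleton h0).mono fun A _ => grade_eq_zero_of_subsingleton _ _⟩
    by_cases h1 : ∃ Q ∈ associatedPrimes B (M ⧸ N), Q ≤ p ∧ I ≤ Q
    · obtain ⟨Q, hQ, hQp, hIQ⟩ := h1
      exact ⟨0, hF.grade_eq_zero hQ J (hJ Q hIQ hQp)⟩
    push Not at h1
    obtain ⟨x, hxI, hx⟩ := exists_mem_annihilator_ker_not_le h1
    let π : M →ₗ[B] QuotSMulTop x (M ⧸ N) := Submodule.mkQ _ ∘ₗ N.mkQ
    have hπ : Function.Surjective π := (Submodule.mkQ_surjective _).comp N.mkQ_surjective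
    have hlt : N < LinearMap.ker π := by
      refine lt_of_le_of_ne (fun y hy => ?_) fun heq => hx ?_
      · rw [LinearMap.mem_ker, LinearMap.comp_apply, Submodule.mkQ_apply N,
          (Submodule.Quotient.mk_eq_zero N).2 hy, map_zero]
      · refine le_trans ?_ h0
        have htop : LinearMap.ker (LinearMap.lsmul B (M ⧸ N) x) = ⊤ := by
          rw [eq_top_iff]
          rintro y -
          obtain ⟨m, rfl⟩ := N.mkQ_surjective y
          have hm : x • m ∈ LinearMap.ker π := by
            rw [LinearMap.mem_ker, LinearMap.comp_apply, map_smul]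
            exact (Submodule.Quotient.mk_eq_zero _).2
              (Submodule.smul_mem_pointwise_smul _ _ _ trivial)
          rw [← heq] at hm
          exact (Submodule.Quotient.mk_eq_zero N).2 hm
        rw [htop, Submodule.topEquiv.annihilator_eq]
    obtain ⟨d, hd⟩ := ih _ hlt
    refine ⟨d + 1, ?_⟩
    filter_upwards [hd, hIJ, hJm, hF.isSMulRegular hx, hF.nontrivial h0] with A hd hIJ hJm hreg hnt
    rw [grade_eq_add_one hJm (hIJ (Ideal.mem_map_of_mem _ hxI)) hreg, ← hd]
    congr 1
    exact grade_congr _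
      (QuotSMulTop.algebraMapTensorEquivTensorQuotSMulTop x (M ⧸ N) A.C ≪≫ₗ
        (π.quotKerEquivOfSurjective hπ).symm.baseChange B A.C _ _)

theorem exists_grade_eq [IsNoetherianRing B] [p.IsPrime]
    (hF : GenericSpecialization p F) (I : Ideal B)
    (M : Type) [AddCommGroup M] [Module B M] [Module.Finite B M] :
    ∃ d : ℕ∞, ∀ᶠ A in F, grade (I.map (algebraMap B A.C)) (A.C ⊗[B] M) = d := by
  by_cases hI : I ≤ p
  · refine hF.exists_grade_eq_of_family I (fun A => I.map (algebraMap B A.C))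
      (.of_forall fun _ => le_rfl) ?_ ?_ M
    · filter_upwards [hF.map_le] with A hA
      exact (Ideal.map_mono hI).trans hA
    · intro Q hIQ hQp
      filter_upwards [hF.map_le] with A hA
      refine ⟨1, fun h => ?_, fun c hc => ?_⟩
      · exact (Ideal.ne_top_iff_one _).1 (maximalIdeal.isMaximal A.C).ne_top
          (hA (Ideal.map_mono hQp h))
      · rw [mul_one]
        exact Ideal.map_mono hIQ hc
  · obtain ⟨h, hhI, hhp⟩ := SetLike.not_le_iff_exists.1 hI
    obtain ⟨d, hd⟩ := hF.exists_grade_eq_of_family p (fun A => maximalIdeal A.C) hF.map_le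
      (.of_forall fun _ => le_rfl)
      (fun Q hpQ hQp => le_antisymm hpQ hQp ▸ hF.socle) M
    refine ⟨d, ?_⟩
    filter_upwards [hd, hF.isUnit hhp] with A hA hu
    rw [Ideal.eq_top_of_isUnit_mem _ (Ideal.mem_map_of_mem _ hhI) hu, grade_top, hA]

theorem annihilator_eq [IsNoetherianRing B] (hF : GenericSpecialization p F)
    (M : Type) [AddCommGroup M] [Module B M] [Module.Finite B M] :
    ∀ᶠ A in F, Module.annihilator A.C (A.C ⊗[B] M) =
      (Module.annihilator B M).map (algebraMap B A.C) := by
  obtain ⟨n, s, hs⟩ := Module.Finite.exists_fin (R := B) (M := M)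
  let f : B →ₗ[B] (Fin n → M) := LinearMap.pi fun i => LinearMap.toSpanSingleton B M (s i)
  have hf : LinearMap.ker f = Module.annihilator B M := by
    ext b
    rw [LinearMap.mem_ker, Module.mem_annihilator]
    refine ⟨fun h m => ?_, fun h => funext fun i => h _⟩
    have hm : m ∈ Submodule.span B (Set.range s) := hs ▸ Submodule.mem_top
    induction hm using Submodule.span_induction with
    | mem x hx => obtain ⟨i, rfl⟩ := hx; exact congrFun h i
    | zero => simp
    | add x y _ _ hx hy => rw [smul_add, hx, hy, add_zero]
    | smul a x _ hx => rw [smul_comm, hx, smul_zero]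
  let g : (B ⧸ Module.annihilator B M) →ₗ[B] (Fin n → M) :=
    (Module.annihilator B M).liftQ f hf.ge
  have hg : Function.Injective g :=
    LinearMap.ker_eq_bot.1 (Submodule.ker_liftQ_eq_bot' _ _ hf.symm)
  filter_upwards [hF.lTensor_injective _ _ g hg] with A hA
  apply le_antisymm
  · intro c hc
    rw [← tmul_mk_one_eq_zero_iff]
    apply hA
    rw [map_zero, LinearMap.lTensor_tmul]
    apply (TensorProduct.piRight B A.C A.C fun _ : Fin n => M).injective
    rw [map_zero]
    ext i
    have hgi : g 1 i = s i := by
      change (1 : B) • s i = s i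
      rw [one_smul]
    change (piRight B A.C A.C fun _ : Fin n => M) (c ⊗ₜ[B] g 1) i = 0
    rw [piRight_apply, piRightHom_tmul]
    change c ⊗ₜ[B] g 1 i = 0
    rw [hgi]
    have := Module.mem_annihilator.1 hc (1 ⊗ₜ[B] s i)
    rwa [smul_tmul', smul_eq_mul, mul_one] at this
  · rw [Ideal.map_le_iff_le_comap]
    intro b hb
    rw [Ideal.mem_comap, Module.mem_annihilator]
    intro y
    rw [← tmul_eq_algebraMap_smul]
    exact smul_eq_zero_of_annihilates (Module.mem_annihilator.1 hb) y

theorem exists_grade_annihilator_eq [IsNoetherianRing B] [p.IsPrime]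
    (hF : GenericSpecialization p F) (M : Type) [AddCommGroup M] [Module B M]
    [Module.Finite B M] :
    ∃ d : ℕ∞, ∀ᶠ A in F, grade (Module.annihilator A.C (A.C ⊗[B] M)) A.C = d := by
  obtain ⟨d, hd⟩ := hF.exists_grade_eq (Module.annihilator B M) B
  refine ⟨d, ?_⟩
  filter_upwards [hd, hF.annihilator_eq M] with A hA hann
  rw [hann, ← hA]
  exact grade_congr _ (AlgebraTensorModule.rid B A.C A.C).symm

end GenericSpecialization

end GenericSpecialization

section PolynomialBaseChange

open TensorProduct

theorem lTensor_injective_of_flat {B R C : Type} [CommRing B] [CommRing R] [CommRing C]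
    [Algebra B R] [Algebra R C] [Algebra B C] [IsScalarTower B R C] [Module.Flat R C]
    {N N' : Type} [AddCommGroup N] [AddCommGroup N'] [Module B N] [Module B N'] (f : N →ₗ[B] N')
    (h : Function.Injective (f.lTensor R)) : Function.Injective (f.lTensor C) := by
  have hC := Module.Flat.lTensor_preserves_injective_linearMap (M := C) (f.baseChange R) h
  let e := AlgebraTensorModule.cancelBaseChange B R R C N
  let e' := AlgebraTensorModule.cancelBaseChange B R R C N'
  have hcomm : ∀ x, f.lTensor C x = e' ((f.baseChange R).lTensor C (e.symm x)) := by
    intro x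
    induction x with
    | zero => simp
    | tmul c y => simp [e, e']
    | add x y hx hy => simp only [map_add, hx, hy]
  intro x y hxy
  rw [hcomm, hcomm] at hxy
  exact e.symm.injective (hC (e'.injective hxy))

theorem lTensor_injective_of_isPushout {A B E R : Type} [CommRing A] [CommRing B] [CommRing E]
    [CommRing R] [Algebra A B] [Algebra A E] [Algebra A R] [Algebra B R] [Algebra E R]
    [IsScalarTower A B R] [IsScalarTower A E R] [Algebra.IsPushout A E B R]
    {N N' : Type} [AddCommGroup N] [AddCommGroup N'] [Module B N] [Module B N'] [Module A N]
    [Module A N'] [IsScalarTower A B N] [IsScalarTower A B N'] (f : N →ₗ[B] N')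
    (h : Function.Injective ((f.restrictScalars A).lTensor E)) :
    Function.Injective (f.lTensor R) := by
  let e := Algebra.IsPushout.cancelBaseChange A E B R N
  let e' := Algebra.IsPushout.cancelBaseChange A E B R N'
  have hcomm : ∀ x, f.lTensor R (e.symm x) = e'.symm ((f.restrictScalars A).lTensor E x) := by
    intro x
    induction x with
    | zero => simp
    | tmul c y => simp [e, e']
    | add x y hx hy => simp only [map_add, hx, hy]
  intro x y hxy
  obtain ⟨x, rfl⟩ := e.symm.surjective x
  obtain ⟨y, rfl⟩ := e.symm.surjective y
  rw [hcomm, hcomm] at hxy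
  rw [h (e'.symm.injective hxy)]

variable {A k' : Type} [CommRing A] [Field k'] {n : ℕ}

/-- The localization of a polynomial ring over a field at a prime ideal, as an algebra over `A[X]`. -/
def LocAlg.atPrime (φ : A →+* k') (q : Ideal (MvPolynomial (Fin n) k')) [q.IsPrime]
    (C : Type) [CommRing C] [Algebra (MvPolynomial (Fin n) k') C] [IsLocalization.AtPrime C q] :
    LocAlg (MvPolynomial (Fin n) A) where
  C := C
  algebra := ((algebraMap (MvPolynomial (Fin n) k') C).comp (MvPolynomial.map φ)).toAlgebra
  isLocalRing := IsLocalization.AtPrime.isLocalRing C q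
  isNoetherianRing := IsLocalization.isNoetherianRing q.primeCompl C inferInstance

attribute [local instance] MvPolynomial.algebraMvPolynomial

theorem LocAlg.atPrime_lTensor_injective [Algebra A k'] (q : Ideal (MvPolynomial (Fin n) k'))
    [q.IsPrime] (C : Type) [CommRing C] [Algebra (MvPolynomial (Fin n) k') C]
    [IsLocalization.AtPrime C q] {N N' : Type} [AddCommGroup N] [AddCommGroup N']
    [Module (MvPolynomial (Fin n) A) N] [Module (MvPolynomial (Fin n) A) N'] [Module A N]
    [Module A N'] [IsScalarTower A (MvPolynomial (Fin n) A) N]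
    [IsScalarTower A (MvPolynomial (Fin n) A) N'] (f : N →ₗ[MvPolynomial (Fin n) A] N')
    (h : Function.Injective ((f.restrictScalars A).lTensor k')) :
    Function.Injective (f.lTensor (LocAlg.atPrime (algebraMap A k') q C).C) := by
  let _ : Algebra (MvPolynomial (Fin n) A) C := (LocAlg.atPrime (algebraMap A k') q C).algebra
  have : IsScalarTower (MvPolynomial (Fin n) A) (MvPolynomial (Fin n) k') C :=
    .of_algebraMap_eq' rfl
  have : Module.Flat (MvPolynomial (Fin n) k') C := IsLocalization.flat C q.primeCompl
  exact lTensor_injective_of_flat (R := MvPolynomial (Fin n) k') (C := C) f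
    (lTensor_injective_of_isPushout (A := A) (E := k') f h)

theorem LocAlg.atPrime_socle (φ : A →+* k') (I : Ideal (MvPolynomial (Fin n) A))
    (q : Ideal (MvPolynomial (Fin n) k')) [q.IsPrime]
    (hq : IsAssociatedPrime q (MvPolynomial (Fin n) k' ⧸ I.map (MvPolynomial.map φ)))
    (C : Type) [CommRing C] [Algebra (MvPolynomial (Fin n) k') C] [IsLocalization.AtPrime C q] :
    ∃ z : (LocAlg.atPrime φ q C).C,
      z ∉ I.map (algebraMap _ (LocAlg.atPrime φ q C).C) ∧
      ∀ c ∈ IsLocalRing.maximalIdeal (LocAlg.atPrime φ q C).C,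
        c * z ∈ I.map (algebraMap _ (LocAlg.atPrime φ q C).C) := by
  have : IsLocalRing C := IsLocalization.AtPrime.isLocalRing C q
  obtain ⟨-, x, hx⟩ := isAssociatedPrime_iff.1 hq
  obtain ⟨r, rfl⟩ := Ideal.Quotient.mk_surjective x
  have hr : ∀ c, c ∈ q ↔ c * r ∈ I.map (MvPolynomial.map φ) := by
    intro c
    rw [hx, Submodule.mem_colon_singleton, Submodule.mem_bot, ← Ideal.Quotient.eq_zero_iff_mem]
    rfl
  have hmap : I.map (algebraMap _ (LocAlg.atPrime φ q C).C) =
      (I.map (MvPolynomial.map φ)).map (algebraMap (MvPolynomial (Fin n) k') C) :=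
    (Ideal.map_map _ _).symm
  suffices h : ∃ z : C,
      z ∉ (I.map (MvPolynomial.map φ)).map (algebraMap (MvPolynomial (Fin n) k') C) ∧
      ∀ c ∈ IsLocalRing.maximalIdeal C,
        c * z ∈ (I.map (MvPolynomial.map φ)).map (algebraMap (MvPolynomial (Fin n) k') C) by
    rw [hmap]
    exact h
  refine ⟨algebraMap (MvPolynomial (Fin n) k') C r, ?_, fun c hc => ?_⟩
  · rw [IsLocalization.algebraMap_mem_map_algebraMap_iff q.primeCompl]
    rintro ⟨s, hs, hsr⟩
    exact hs ((hr s).2 hsr)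
  · rw [← IsLocalization.AtPrime.map_eq_maximalIdeal q C] at hc
    have : Ideal.map (algebraMap (MvPolynomial (Fin n) k') C) q ≤
        ((I.map (MvPolynomial.map φ)).map (algebraMap (MvPolynomial (Fin n) k') C)).colon
          {algebraMap (MvPolynomial (Fin n) k') C r} := by
      rw [Ideal.map_le_iff_le_comap]
      intro y hy
      rw [Ideal.mem_comap, Submodule.mem_colon_singleton, smul_eq_mul, ← map_mul]
      exact Ideal.mem_map_of_mem _ ((hr y).1 hy)
    exact Submodule.mem_colon_singleton.1 (this hc)

end PolynomialBaseChange

section SpecializationFilter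

open TensorProduct Filter

variable {K : Type} [Field K] {m n : ℕ}

theorem AlmostAll.mono {Q Q' : (Fin m → K) → Prop} (h : AlmostAll K m Q) (hQ : ∀ α, Q α → Q' α) :
    AlmostAll K m Q' := by
  obtain ⟨c, hc, h⟩ := h
  exact ⟨c, hc, fun α hα => hQ α (h α hα)⟩

theorem AlmostAll.of_forall {Q : (Fin m → K) → Prop} (h : ∀ α, Q α) : AlmostAll K m Q :=
  ⟨1, one_ne_zero, fun α _ => h α⟩

theorem AlmostAll.and {Q Q' : (Fin m → K) → Prop} (h : AlmostAll K m Q) (h' : AlmostAll K m Q') :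
    AlmostAll K m fun α => Q α ∧ Q' α := by
  obtain ⟨c, hc, h⟩ := h
  obtain ⟨c', hc', h'⟩ := h'
  refine ⟨c * c', mul_ne_zero hc hc', fun α hα => ?_⟩
  rw [map_mul] at hα
  exact ⟨h α (left_ne_zero_of_mul hα), h' α (right_ne_zero_of_mul hα)⟩

variable {k : Type} [Field k] [Algebra k K]

theorem coe_evalα (α : Fin m → K) (c : MvPolynomial (Fin m) k) :
    (evalα k K α c : K) = MvPolynomial.eval α (MvPolynomial.map (algebraMap k K) c) := by
  rw [MvPolynomial.eval_map, ← MvPolynomial.aeval_def]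
  change (kA k K α).val (MvPolynomial.aeval _ c) = _
  rw [MvPolynomial.comp_aeval_apply]
  rfl

theorem almostAll_evalα_ne_zero {c : MvPolynomial (Fin m) k} (hc : c ≠ 0) :
    AlmostAll K m fun α => evalα k K α c ≠ 0 := by
  refine ⟨MvPolynomial.map (algebraMap k K) c,
    (map_ne_zero_iff _ (MvPolynomial.map_injective _ (algebraMap k K).injective)).2 hc,
    fun α hα h => hα ?_⟩
  rw [← coe_evalα, h, ZeroMemClass.coe_zero]

variable (K) in
/-- The filter of sets containing almost all the specializations of the localization at `P`. -/
def specFilter (P : Ideal (Rg k m n)) :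
    Filter (LocAlg (MvPolynomial (Fin n) (MvPolynomial (Fin m) k))) where
  sets := {U | AlmostAll K m fun α =>
    ∀ (℘ : Ideal (Ra k K n α))
      (h℘ : IsAssociatedPrime ℘ ((Ra k K n α) ⧸ idealSpec k K n α P)),
      haveI := h℘.isPrime
      ∀ (Sα : Type) [CommRing Sα] [Algebra (Ra k K n α) Sα] [IsLocalization.AtPrime Sα ℘],
        LocAlg.atPrime (evalα k K α) ℘ Sα ∈ U}
  univ_sets := .of_forall fun _ _ _ _ _ _ _ => Set.mem_univ _
  sets_of_superset h hUV := h.mono fun _ h ℘ h℘ Sα _ _ _ => hUV (h ℘ h℘ Sα)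
  inter_sets h h' := (h.and h').mono fun _ h ℘ h℘ Sα _ _ _ => ⟨h.1 ℘ h℘ Sα, h.2 ℘ h℘ Sα⟩

theorem eventually_specFilter {P : Ideal (Rg k m n)}
    {T : LocAlg (MvPolynomial (Fin n) (MvPolynomial (Fin m) k)) → Prop} :
    (∀ᶠ A in specFilter K P, T A) ↔ AlmostAll K m fun α =>
      ∀ (℘ : Ideal (Ra k K n α))
        (h℘ : IsAssociatedPrime ℘ ((Ra k K n α) ⧸ idealSpec k K n α P)),
        haveI := h℘.isPrime
        ∀ (Sα : Type) [CommRing Sα] [Algebra (Ra k K n α) Sα] [IsLocalization.AtPrime Sα ℘],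
          T (LocAlg.atPrime (evalα k K α) ℘ Sα) :=
  Iff.rfl

theorem genericSpecialization_specFilter (P : Ideal (Rg k m n)) :
    GenericSpecialization (P.comap (toR k m n)) (specFilter K P) where
  lTensor_injective N N' _ _ _ _ _ _ f hf := by
    let _ : Module (MvPolynomial (Fin m) k) N := Module.compHom N
      (algebraMap (MvPolynomial (Fin m) k) (MvPolynomial (Fin n) (MvPolynomial (Fin m) k)))
    let _ : Module (MvPolynomial (Fin m) k) N' := Module.compHom N'
      (algebraMap (MvPolynomial (Fin m) k) (MvPolynomial (Fin n) (MvPolynomial (Fin m) k)))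
    have : IsScalarTower (MvPolynomial (Fin m) k)
        (MvPolynomial (Fin n) (MvPolynomial (Fin m) k)) N := .of_algebraMap_smul fun _ _ => rfl
    have : IsScalarTower (MvPolynomial (Fin m) k)
        (MvPolynomial (Fin n) (MvPolynomial (Fin m) k)) N' := .of_algebraMap_smul fun _ _ => rfl
    obtain ⟨c, hc, hcE⟩ := genericallyTorVanishing_mvPolynomial (MvPolynomial (Fin m) k) n
      (N' ⧸ LinearMap.range f)
    refine eventually_specFilter.2 ((almostAll_evalα_ne_zero hc).mono fun α hα ℘ h℘ Sα _ _ _ => ?_)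
    have := h℘.isPrime
    let _ : Algebra (MvPolynomial (Fin m) k) (kA k K α) := (evalα k K α).toAlgebra
    refine LocAlg.atPrime_lTensor_injective ℘ Sα f ?_
    have hT := hcE (kA k K α) ((mulLeft_bijective₀ (evalα k K α c) hα))
    exact (LinearMap.lTensor_inj_iff_rTensor_inj _ _).2 <| hT.rTensor_injective _
      ((LinearMap.range f).mkQ.restrictScalars (MvPolynomial (Fin m) k)) hf
      (Submodule.mkQ_surjective _) (LinearMap.exact_map_mkQ_range f)
  socle := eventually_specFilter.2 <| .of_forall fun α ℘ h℘ Sα _ _ _ =>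
    have := h℘.isPrime
    LocAlg.atPrime_socle (evalα k K α) (P.comap (toR k m n)) ℘ h℘ Sα

theorem map_comap_toR (P : Ideal (Rg k m n)) : (P.comap (toR k m n)).map (toR k m n) = P := by
  let _ : Algebra (MvPolynomial (Fin n) (MvPolynomial (Fin m) k)) (Rg k m n) :=
    MvPolynomial.algebraMvPolynomial
  have := MvPolynomial.isLocalization (σ := Fin n) (nonZeroDivisors (MvPolynomial (Fin m) k))
    (kU k m)
  exact IsLocalization.map_under ((nonZeroDivisors (MvPolynomial (Fin m) k)).map MvPolynomial.C)
    (Rg k m n) P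

theorem isAssociatedPrime_quotient_self {R : Type} [CommRing R] [IsNoetherianRing R] (P : Ideal R)
    [P.IsPrime] : IsAssociatedPrime P (R ⧸ P) := by
  refine isAssociatedPrime_iff.2 ⟨inferInstance, Ideal.Quotient.mk P 1, Ideal.ext fun c => ?_⟩
  rw [Submodule.mem_colon_singleton, Submodule.mem_bot, ← Ideal.Quotient.mk_eq_mk,
    ← Submodule.Quotient.mk_smul, smul_eq_mul, mul_one]
  exact (Submodule.Quotient.mk_eq_zero P).symm

theorem genericSpecialization_pure (P : Ideal (Rg k m n)) [P.IsPrime] (S : Type) [CommRing S]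
    [Algebra (Rg k m n) S] [IsLocalization.AtPrime S P] :
    GenericSpecialization (P.comap (toR k m n))
      (pure (LocAlg.atPrime (algebraMap (MvPolynomial (Fin m) k) (kU k m)) P S)) where
  lTensor_injective N N' _ _ _ _ _ _ f hf := by
    let _ : Module (MvPolynomial (Fin m) k) N := Module.compHom N
      (algebraMap (MvPolynomial (Fin m) k) (MvPolynomial (Fin n) (MvPolynomial (Fin m) k)))
    let _ : Module (MvPolynomial (Fin m) k) N' := Module.compHom N'
      (algebraMap (MvPolynomial (Fin m) k) (MvPolynomial (Fin n) (MvPolynomial (Fin m) k)))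
    have : IsScalarTower (MvPolynomial (Fin m) k)
        (MvPolynomial (Fin n) (MvPolynomial (Fin m) k)) N := .of_algebraMap_smul fun _ _ => rfl
    have : IsScalarTower (MvPolynomial (Fin m) k)
        (MvPolynomial (Fin n) (MvPolynomial (Fin m) k)) N' := .of_algebraMap_smul fun _ _ => rfl
    refine eventually_pure.2 (LocAlg.atPrime_lTensor_injective P S f ?_)
    have : Module.Flat (MvPolynomial (Fin m) k) (kU k m) :=
      IsLocalization.flat _ (nonZeroDivisors (MvPolynomial (Fin m) k))
    exact Module.Flat.lTensor_preserves_injective_linearMap _ hf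
  socle := eventually_pure.2 <| LocAlg.atPrime_socle _ _ P (by
    change IsAssociatedPrime P (_ ⧸ (P.comap (toR k m n)).map (toR k m n))
    rw [map_comap_toR]
    exact isAssociatedPrime_quotient_self P) S

theorem GenericSpecialization.sup {B : Type} [CommRing B] {p : Ideal B} {F G : Filter (LocAlg B)}
    (hF : GenericSpecialization p F) (hG : GenericSpecialization p G) :
    GenericSpecialization p (F ⊔ G) where
  lTensor_injective N N' _ _ _ _ _ _ f hf :=
    eventually_sup.2 ⟨hF.lTensor_injective N N' f hf, hG.lTensor_injective N N' f hf⟩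
  socle := eventually_sup.2 ⟨hF.socle, hG.socle⟩

end SpecializationFilter

section Assembly

open TensorProduct Filter

theorem range_mulVecLin_smul {C : Type} [CommRing C] {r s : ℕ} {d : C} (hd : IsUnit d)
    (A : Matrix (Fin r) (Fin s) C) :
    LinearMap.range (d • A).mulVecLin = LinearMap.range A.mulVecLin := by
  obtain ⟨u, rfl⟩ := hd
  ext x
  simp only [LinearMap.mem_range, Matrix.mulVecLin_apply, Matrix.smul_mulVec]
  constructor
  · rintro ⟨y, rfl⟩
    exact ⟨(u : C) • y, Matrix.mulVec_smul _ _ _⟩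
  · rintro ⟨y, rfl⟩
    exact ⟨(↑u⁻¹ : C) • y, by rw [Matrix.mulVec_smul, smul_smul, Units.mul_inv, one_smul]⟩

section BaseChange

variable {B C : Type} [CommRing B] [CommRing C] [Algebra B C] {r s t : ℕ}

theorem exists_matCoker_map_equiv (N : Matrix (Fin r) (Fin s) B) :
    Nonempty (MatCoker (N.map (algebraMap B C)) ≃ₗ[C] C ⊗[B] MatCoker N) := by
  let e (i : ℕ) : C ⊗[B] (Fin i → B) ≃ₗ[C] (Fin i → C) := piScalarRight B C C (Fin i)
  let q := (LinearMap.range N.mulVecLin).mkQ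
  let π : (Fin r → C) →ₗ[C] C ⊗[B] MatCoker N := q.baseChange C ∘ₗ (e r).symm.toLinearMap
  have hπ : Function.Surjective π :=
    (LinearMap.lTensor_surjective C (Submodule.mkQ_surjective _)).comp (e r).symm.surjective
  have hexact : Function.Exact (N.mulVecLin.lTensor C) (q.lTensor C) :=
    lTensor_exact C (LinearMap.exact_map_mkQ_range _) (Submodule.mkQ_surjective _)
  have hN (y : C ⊗[B] (Fin s → B)) :
      e r (N.mulVecLin.lTensor C y) = (N.map (algebraMap B C)).mulVec (e s y) := by
    induction y with
    | zero => simp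
    | tmul c v =>
      ext i
      simp [e, Matrix.mulVec, dotProduct, Algebra.smul_def, Finset.sum_mul, mul_assoc]
    | add x y hx hy => simp only [map_add, hx, hy, Matrix.mulVec_add]
  have hker : LinearMap.ker π = LinearMap.range (N.map (algebraMap B C)).mulVecLin := by
    ext x
    refine (hexact ((e r).symm x)).trans ?_
    constructor
    · rintro ⟨y, hy⟩
      exact ⟨e s y, by rw [Matrix.mulVecLin_apply, ← hN, hy, LinearEquiv.apply_symm_apply]⟩
    · rintro ⟨y, rfl⟩
      refine ⟨(e s).symm y, (e r).injective ?_⟩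
      rw [hN, LinearEquiv.apply_symm_apply, LinearEquiv.apply_symm_apply, Matrix.mulVecLin_apply]
  exact ⟨Submodule.quotEquivOfEq _ _ hker.symm ≪≫ₗ π.quotKerEquivOfSurjective hπ⟩

variable {D : B}

theorem exists_matCoker_equiv (hD : IsUnit (algebraMap B C D)) {E : Matrix (Fin r) (Fin s) C}
    {N : Matrix (Fin r) (Fin s) B}
    (h : ∀ i j, algebraMap B C D * E i j = algebraMap B C (N i j)) :
    Nonempty (MatCoker E ≃ₗ[C] C ⊗[B] MatCoker N) := by
  obtain ⟨e⟩ := exists_matCoker_map_equiv (C := C) N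
  refine ⟨Submodule.quotEquivOfEq _ _ ?_ ≪≫ₗ e⟩
  rw [← range_mulVecLin_smul hD]
  congr 2
  ext i j
  exact h i j

theorem span_range_eq_map (hD : IsUnit (algebraMap B C D)) {b : Fin t → C} {v : Fin t → B}
    (h : ∀ i, algebraMap B C D * b i = algebraMap B C (v i)) :
    Ideal.span (Set.range b) = (Ideal.span (Set.range v)).map (algebraMap B C) := by
  rw [Ideal.map_span]
  refine le_antisymm (Ideal.span_le.2 ?_) (Ideal.span_le.2 ?_)
  · rintro _ ⟨i, rfl⟩
    rw [SetLike.mem_coe, ← Ideal.unit_mul_mem_iff_mem _ hD, h]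
    exact Ideal.subset_span (Set.mem_image_of_mem _ (Set.mem_range_self i))
  · rintro _ ⟨_, ⟨i, rfl⟩, rfl⟩
    rw [SetLike.mem_coe, ← h]
    exact Ideal.mul_mem_left _ _ (Ideal.subset_span (Set.mem_range_self i))

theorem grade_matCoker_eq (hD : IsUnit (algebraMap B C D)) {E : Matrix (Fin r) (Fin s) C}
    {N : Matrix (Fin r) (Fin s) B}
    (h : ∀ i j, algebraMap B C D * E i j = algebraMap B C (N i j)) {b : Fin t → C} {v : Fin t → B}
    (h' : ∀ i, algebraMap B C D * b i = algebraMap B C (v i)) :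
    grade (Ideal.span (Set.range b)) (MatCoker E) =
        grade ((Ideal.span (Set.range v)).map (algebraMap B C)) (C ⊗[B] MatCoker N) ∧
      grade (Module.annihilator C (MatCoker E)) C =
        grade (Module.annihilator C (C ⊗[B] MatCoker N)) C := by
  obtain ⟨e⟩ := exists_matCoker_equiv hD h
  rw [span_range_eq_map hD h', grade_congr _ e, e.annihilator_eq]
  exact ⟨rfl, rfl⟩

end BaseChange

variable {k K : Type} [Field k] [Field K] [Algebra k K] {m n : ℕ}

theorem toR_injective : Function.Injective (toR k m n) :=
  MvPolynomial.map_injective _ (IsFractionRing.injective _ _)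

theorem ElemSpec.mul_toRa_eq {α : Fin m → K} {f g : Rg k m n} {fα gα : Ra k K n α}
    (hf : ElemSpec k K n α f fα) (hg : ElemSpec k K n α g gα)
    {D N : MvPolynomial (Fin n) (MvPolynomial (Fin m) k)}
    (h : toR k m n D * f = toR k m n N * g) : toRa k K n α D * fα = toRa k K n α N * gα := by
  obtain ⟨pf, qf, hqf, hpf, hpfα⟩ := hf
  obtain ⟨pg, qg, hqg, hpg, hpgα⟩ := hg
  have hC (q : MvPolynomial (Fin m) k) : toR k m n (MvPolynomial.C q) =
      MvPolynomial.C (algebraMap (MvPolynomial (Fin m) k) (kU k m) q) := MvPolynomial.map_C _ _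
  have hCα (q : MvPolynomial (Fin m) k) : toRa k K n α (MvPolynomial.C q) =
      MvPolynomial.C (evalα k K α q) := MvPolynomial.map_C _ _
  have key : D * pf * MvPolynomial.C qg = N * pg * MvPolynomial.C qf := by
    apply toR_injective
    simp only [map_mul, hC, ← hpf, ← hpg]
    linear_combination MvPolynomial.C (algebraMap (MvPolynomial (Fin m) k) (kU k m) qf) *
      MvPolynomial.C (algebraMap (MvPolynomial (Fin m) k) (kU k m) qg) * h
  have keyα := congrArg (toRa k K n α) key
  simp only [map_mul, hCα, ← hpfα, ← hpgα] at keyα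
  have hne : (MvPolynomial.C (evalα k K α qf) * MvPolynomial.C (evalα k K α qg) : Ra k K n α) ≠ 0 :=
    mul_ne_zero ((MvPolynomial.C_ne_zero).2 hqf) ((MvPolynomial.C_ne_zero).2 hqg)
  exact mul_left_cancel₀ hne (by linear_combination keyα)

theorem LocElemSpec.mul_toRa_eq {α : Fin m → K} {P : Ideal (Rg k m n)} [P.IsPrime]
    {℘ : Ideal (Ra k K n α)} [℘.IsPrime] {S : Type} [CommRing S] [Algebra (Rg k m n) S]
    [IsLocalization.AtPrime S P] {Sα : Type} [CommRing Sα] [Algebra (Ra k K n α) Sα]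
    [IsLocalization.AtPrime Sα ℘] {a : S} {aα : Sα} (ha : LocElemSpec P ℘ a aα)
    {D N : MvPolynomial (Fin n) (MvPolynomial (Fin m) k)}
    (h : algebraMap (Rg k m n) S (toR k m n D) * a = algebraMap (Rg k m n) S (toR k m n N)) :
    algebraMap (Ra k K n α) Sα (toRa k K n α D) * aα =
      algebraMap (Ra k K n α) Sα (toRa k K n α N) := by
  obtain ⟨f, g, fα, gα, hg, hgα, hf, hgs, rfl, rfl⟩ := ha
  rw [IsLocalization.mul_mk'_eq_mk'_of_mul, IsLocalization.mk'_eq_iff_eq_mul, ← map_mul] at h ⊢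
  exact congrArg _ (hf.mul_toRa_eq hgs
    (IsLocalization.injective S P.primeCompl_le_nonZeroDivisors h))

theorem exists_common_denominator (P : Ideal (Rg k m n)) [P.IsPrime] (S : Type) [CommRing S]
    [Algebra (Rg k m n) S] [IsLocalization.AtPrime S P] {ι : Type} [Finite ι] (F : ι → S) :
    ∃ D ∉ P.comap (toR k m n), ∃ N : ι → MvPolynomial (Fin n) (MvPolynomial (Fin m) k),
      ∀ i, algebraMap (Rg k m n) S (toR k m n D) * F i =
        algebraMap (Rg k m n) S (toR k m n (N i)) := by
  let _ : Algebra (MvPolynomial (Fin n) (MvPolynomial (Fin m) k)) (Rg k m n) :=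
    MvPolynomial.algebraMvPolynomial
  have := MvPolynomial.isLocalization (σ := Fin n) (nonZeroDivisors (MvPolynomial (Fin m) k))
    (kU k m)
  let _ : Algebra (MvPolynomial (Fin n) (MvPolynomial (Fin m) k)) S :=
    ((algebraMap (Rg k m n) S).comp (toR k m n)).toAlgebra
  have : IsScalarTower (MvPolynomial (Fin n) (MvPolynomial (Fin m) k)) (Rg k m n) S :=
    .of_algebraMap_eq' rfl
  have : IsLocalization.AtPrime S (P.comap (toR k m n)) :=
    IsLocalization.isLocalization_isLocalization_atPrime_isLocalization
      ((nonZeroDivisors (MvPolynomial (Fin m) k)).map MvPolynomial.C) S P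
  obtain ⟨D, hD⟩ := IsLocalization.exist_integer_multiples_of_finite
    (P.comap (toR k m n)).primeCompl F
  choose N hN using hD
  exact ⟨D, D.2, N, fun i => ((hN i).trans (Algebra.smul_def _ _)).symm⟩

theorem Present.exists_matCoker_equiv {S L : Type} [CommRing S] [AddCommGroup L] [Module S L]
    {r s : ℕ} (p : Present S r s L) : Nonempty (MatCoker p.A ≃ₗ[S] L) :=
  ⟨Submodule.quotEquivOfEq _ _ p.ker_eq.symm ≪≫ₗ p.π.quotKerEquivOfSurjective p.surj⟩

end Assembly

/-- for a finitely generated `S`-module `L` and an ideal `𝔞` of `S`,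
for almost all `α`: (i) `grade(𝔞_α, L_α) = grade(𝔞, L)` and
(ii) `grade L_α = grade L`, where `grade(𝔞, L)` is the length of a maximal
`L`-regular sequence in `𝔞` and `grade L = grade(Ann L, S)`;  here
`𝔞_α = ((a_1)_α, …, (a_t)_α)` for a fixed system of generators of `𝔞`. -/
theorem specialization_preserves_grade
    (k K : Type) [Field k] [Field K] [Algebra k K] [Infinite K] {m n : ℕ}
    (P : Ideal (Rg k m n)) [P.IsPrime]
    (S : Type) [CommRing S] [Algebra (Rg k m n) S] [IsLocalization.AtPrime S P]
    (L : Type) [AddCommGroup L] [Module S L] [Module.Finite S L]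
    (𝔞 : Ideal S) {t : ℕ} (a : Fin t → S) (ha : Ideal.span (Set.range a) = 𝔞)
    {rL sL : ℕ} (pL : Present S rL sL L) :
    AlmostAll K m fun α =>
      ∀ (℘ : Ideal (Ra k K n α))
        (h℘ : IsAssociatedPrime ℘ ((Ra k K n α) ⧸ idealSpec k K n α P)),
        haveI := h℘.isPrime
        ∀ (Sα : Type) [CommRing Sα] [Algebra (Ra k K n α) Sα]
          [IsLocalization.AtPrime Sα ℘]
          (B : Matrix (Fin rL) (Fin sL) Sα) (b : Fin t → Sα),
          MatSpec (LocElemSpec P ℘) pL.A B →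
          (∀ i, LocElemSpec P ℘ (a i) (b i)) →
          grade (Ideal.span (Set.range b)) (MatCoker B) = grade 𝔞 L ∧
          grade (Module.annihilator Sα (MatCoker B)) Sα =
            grade (Module.annihilator S L) S := by
  obtain ⟨D, hD, N, hN⟩ := exists_common_denominator P S
    (Sum.elim (fun ij : Fin rL × Fin sL => pL.A ij.1 ij.2) a)
  let M : Matrix (Fin rL) (Fin sL) (MvPolynomial (Fin n) (MvPolynomial (Fin m) k)) :=
    fun i j => N (.inl (i, j))
  let v := fun i => N (.inr i)
  have hG := (genericSpecialization_specFilter (K := K) P).sup (genericSpecialization_pure P S)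
  have := P.comap_isPrime (toR k m n)
  obtain ⟨d, hd⟩ := hG.exists_grade_eq (Ideal.span (Set.range v)) (MatCoker M)
  obtain ⟨d', hd'⟩ := hG.exists_grade_annihilator_eq (MatCoker M)
  obtain ⟨hspec, hpure⟩ := Filter.eventually_sup.1 ((hd.and hd').and (hG.isUnit hD))
  obtain ⟨⟨hS, hS'⟩, hSu⟩ := Filter.eventually_pure.1 hpure
  refine (eventually_specFilter.1 hspec).mono fun α h ℘ h℘ Sα _ _ _ B b hB hb => ?_
  have := h℘.isPrime
  obtain ⟨⟨hα, hα'⟩, hαu⟩ := h ℘ h℘ Sα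
  obtain ⟨eL⟩ := pL.exists_matCoker_equiv
  have hgrade := grade_matCoker_eq hSu (N := M) (v := v) (E := pL.A) (b := a)
    (fun i j => hN (.inl (i, j))) (fun i => hN (.inr i))
  have hgradeα := grade_matCoker_eq hαu (N := M) (v := v) (E := B) (b := b)
    (fun i j => (hB i j).mul_toRa_eq (hN (.inl (i, j)))) (fun i => (hb i).mul_toRa_eq (hN (.inr i)))
  rw [← ha, ← grade_congr _ eL, ← eL.annihilator_eq]
  exact ⟨(hgradeα.1.trans hα).trans (hgrade.1.trans hS).symm,
    (hgradeα.2.trans hα').trans (hgrade.2.trans hS').symm⟩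

end Spl
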